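/- arXiv:2104.13438 — 12 statements merged into one kernel-verified Lean document; each statement's English description precedes it below -/
import Mathlib

section
/- Let a and b be nonzero rational numbers and let B = ℍ[ℚ, a, b] be the quaternion algebra over ℚ with generators i, j satisfying i² = a, j² = b, ji = −ij. For every x ∈ B that is not in the image of the structure map ℚ → B, the centralizer C_B(x) = {v ∈ B : v·x = x·v} is exactly the ℚ-linear span of {1, x}; in particular C_B(x) is a ℚ-subalgebra of B of ℚ-dimension 2. -/
open Quaternion

namespace QuaternionAlgebra

variable {K : Type*} [Field K] {a b : K}

theorem mem_range_algebraMap_iff {x : ℍ[K, a, b]} :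
    x ∈ Set.range (algebraMap K ℍ[K, a, b]) ↔ x.imI = 0 ∧ x.imJ = 0 ∧ x.imK = 0 := by
  constructor
  · rintro ⟨r, rfl⟩
    simp [algebraMap_eq]
  · rintro ⟨hI, hJ, hK⟩
    exact ⟨x.re, by ext <;> simp [algebraMap_eq, hI, hJ, hK]⟩

/-- Commuting quaternions have parallel imaginary parts. -/
theorem cross_eq_zero_of_mul_comm [NeZero (2 : K)] (ha : a ≠ 0) (hb : b ≠ 0)
    {v x : ℍ[K, a, b]} (h : v * x = x * v) :
    v.imJ * x.imK = v.imK * x.imJ ∧ v.imI * x.imK = v.imK * x.imI ∧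
      v.imI * x.imJ = v.imJ * x.imI := by
  have h2 : (2 : K) ≠ 0 := NeZero.ne 2
  have hI := congrArg imI h
  have hJ := congrArg imJ h
  have hK := congrArg imK h
  simp only [imI_mul, imJ_mul, imK_mul] at hI hJ hK
  refine ⟨mul_left_cancel₀ (mul_ne_zero h2 hb) ?_, mul_left_cancel₀ (mul_ne_zero h2 ha) ?_,
    mul_left_cancel₀ h2 ?_⟩
  · linear_combination -hI
  · linear_combination hJ
  · linear_combination hK

theorem mul_comm_iff_mem_span_one_self [NeZero (2 : K)] (ha : a ≠ 0) (hb : b ≠ 0)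
    {x : ℍ[K, a, b]} (hx : x ∉ Set.range (algebraMap K ℍ[K, a, b])) {v : ℍ[K, a, b]} :
    v * x = x * v ↔ v ∈ Submodule.span K ({1, x} : Set ℍ[K, a, b]) := by
  rw [Submodule.mem_span_pair]
  constructor
  · intro h
    obtain ⟨h₁, h₂, h₃⟩ := cross_eq_zero_of_mul_comm ha hb h
    obtain ⟨t, hI, hJ, hK⟩ :
        ∃ t, t * x.imI = v.imI ∧ t * x.imJ = v.imJ ∧ t * x.imK = v.imK := by
      rw [mem_range_algebraMap_iff] at hx
      by_cases hI : x.imI = 0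
      · by_cases hJ : x.imJ = 0
        · have hK : x.imK ≠ 0 := fun hK ↦ hx ⟨hI, hJ, hK⟩
          refine ⟨v.imK / x.imK, ?_, ?_, ?_⟩ <;> field_simp <;> grind
        · refine ⟨v.imJ / x.imJ, ?_, ?_, ?_⟩ <;> field_simp <;> grind
      · refine ⟨v.imI / x.imI, ?_, ?_, ?_⟩ <;> field_simp <;> grind
    exact ⟨v.re - t * x.re, t, by ext <;> simp [hI, hJ, hK]⟩
  · rintro ⟨r, s, rfl⟩
    simp [add_mul, mul_add]

theorem linearIndependent_one_self {x : ℍ[K, a, b]}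
    (hx : x ∉ Set.range (algebraMap K ℍ[K, a, b])) :
    LinearIndependent K ![1, x] := by
  rw [LinearIndependent.pair_iff' one_ne_zero]
  intro r hr
  exact hx ⟨r, by rw [Algebra.algebraMap_eq_smul_one, hr]⟩

end QuaternionAlgebra

/-- For `x ∈ ℍ[ℚ, a, b]` (with `a, b ≠ 0`) not in the image of `ℚ`, the centralizer of `x`
is exactly the `ℚ`-span of `{1, x}`; in particular it is a `ℚ`-subalgebra of dimension 2. -/
theorem stmt_0 (a b : ℚ) (ha : a ≠ 0) (hb : b ≠ 0) (x : ℍ[ℚ, a, b])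
    (hx : x ∉ Set.range (algebraMap ℚ ℍ[ℚ, a, b])) :
    {v : ℍ[ℚ, a, b] | v * x = x * v} =
      (Submodule.span ℚ ({1, x} : Set ℍ[ℚ, a, b]) : Set ℍ[ℚ, a, b]) ∧
    Module.finrank ℚ (Subalgebra.centralizer ℚ ({x} : Set ℍ[ℚ, a, b])) = 2 := by
  refine ⟨Set.ext fun v ↦ QuaternionAlgebra.mul_comm_iff_mem_span_one_self ha hb hx, ?_⟩
  have h : Subalgebra.toSubmodule (Subalgebra.centralizer ℚ ({x} : Set ℍ[ℚ, a, b])) =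
      Submodule.span ℚ (Set.range ![1, x]) := by
    ext v
    rw [Matrix.range_cons_cons_empty,
      ← QuaternionAlgebra.mul_comm_iff_mem_span_one_self ha hb hx,
      Subalgebra.mem_toSubmodule, Subalgebra.mem_centralizer_iff]
    simp [eq_comm]
  rw [← Subalgebra.finrank_toSubmodule, h,
    finrank_span_eq_card (QuaternionAlgebra.linearIndependent_one_self hx), Fintype.card_fin]
end

section
/- Let p be a prime and k a natural number. For every 2×2 matrix z with entries in the p-adic integers ℤ_p such that det z = p^k, there exist unique natural numbers a and b with a ≤ k and b < p^{k−a}, and a unique u ∈ SL(2, ℤ_p), such that z = u · !![p^a, b; 0, p^{k−a}]. Consequently, the number of orbits of the left-multiplication action of SL(2, ℤ_p) on {z ∈ M₂(ℤ_p) : det z = p^k} equals 1 + p + p² + ⋯ + p^k. -/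
open scoped MatrixGroups

/-- The left-multiplication action of `SL(2, ℤ_[p])` on 2×2 matrices over `ℤ_[p]` of
determinant `p^k`. -/
noncomputable instance stmt2Action (p : ℕ) [Fact p.Prime] (k : ℕ) :
    MulAction SL(2, ℤ_[p])
      {z : Matrix (Fin 2) (Fin 2) ℤ_[p] // z.det = (p : ℤ_[p]) ^ k} where
  smul u z := ⟨(u : Matrix (Fin 2) (Fin 2) ℤ_[p]) * z.1, by
    rw [Matrix.det_mul, Matrix.SpecialLinearGroup.det_coe, one_mul, z.2]⟩
  one_smul z := Subtype.ext (by
    show ((1 : SL(2, ℤ_[p])) : Matrix (Fin 2) (Fin 2) ℤ_[p]) * z.1 = z.1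
    simp)
  mul_smul u v z := Subtype.ext (by
    show ((u * v : SL(2, ℤ_[p])) : Matrix (Fin 2) (Fin 2) ℤ_[p]) * z.1 =
      (u : Matrix (Fin 2) (Fin 2) ℤ_[p]) * ((v : Matrix (Fin 2) (Fin 2) ℤ_[p]) * z.1)
    simp [Matrix.mul_assoc])

/-- A nonzero ideal of `ℤ_[p]` generated by two elements is generated by a power of `p`, which
is a combination of the generators with coprime cofactors. -/
theorem PadicInt.exists_pow_mul_coprime {p : ℕ} [Fact p.Prime] {x s : ℤ_[p]}
    (h : ¬(x = 0 ∧ s = 0)) :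
    ∃ (a : ℕ) (x' s' α β : ℤ_[p]), x = (p : ℤ_[p]) ^ a * x' ∧ s = (p : ℤ_[p]) ^ a * s' ∧
      α * x' + β * s' = 1 := by
  have hne : Ideal.span {x, s} ≠ ⊥ := by
    simpa [Ideal.span_eq_bot] using h
  obtain ⟨a, ha⟩ := PadicInt.ideal_eq_span_pow_p hne
  have hx : x ∈ Ideal.span {(p : ℤ_[p]) ^ a} := ha ▸ Ideal.subset_span (by simp)
  have hs : s ∈ Ideal.span {(p : ℤ_[p]) ^ a} := ha ▸ Ideal.subset_span (by simp)
  have hp : (p : ℤ_[p]) ^ a ∈ Ideal.span {x, s} := ha ▸ Ideal.mem_span_singleton_self _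
  obtain ⟨x', rfl⟩ := Ideal.mem_span_singleton.mp hx
  obtain ⟨s', rfl⟩ := Ideal.mem_span_singleton.mp hs
  obtain ⟨α, β, hαβ⟩ := Ideal.mem_span_pair.mp hp
  refine ⟨a, x', s', α, β, rfl, rfl, ?_⟩
  apply mul_left_cancel₀ (pow_ne_zero a PadicInt.prime_p.ne_zero)
  linear_combination hαβ

/-- Existence of the Hermite normal form over `ℤ_[p]`. -/
theorem PadicInt.exists_hermite_form {p : ℕ} [Fact p.Prime] {k : ℕ}
    {z : Matrix (Fin 2) (Fin 2) ℤ_[p]} (hz : z.det = (p : ℤ_[p]) ^ k) :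
    ∃ a ≤ k, ∃ b < p ^ (k - a), ∃ u : SL(2, ℤ_[p]),
      z = (u : Matrix (Fin 2) (Fin 2) ℤ_[p]) *
        !![(p : ℤ_[p]) ^ a, (b : ℤ_[p]); 0, (p : ℤ_[p]) ^ (k - a)] := by
  have hp : Prime (p : ℤ_[p]) := PadicInt.prime_p
  rw [Matrix.det_fin_two] at hz
  have hne : ¬(z 0 0 = 0 ∧ z 1 0 = 0) := by
    rintro ⟨h0, h1⟩
    rw [h0, h1] at hz
    exact pow_ne_zero k hp.ne_zero (by linear_combination -hz)
  obtain ⟨a, x', s', α, β, hx, hs, hαβ⟩ := PadicInt.exists_pow_mul_coprime hne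
  have hdet : (p : ℤ_[p]) ^ k = (p : ℤ_[p]) ^ a * (x' * z 1 1 - z 0 1 * s') := by
    rw [← hz, hx, hs]; ring
  have hak : a ≤ k := (pow_dvd_pow_iff hp.ne_zero hp.not_isUnit).mp ⟨_, hdet⟩
  have hD : (p : ℤ_[p]) ^ (k - a) = x' * z 1 1 - z 0 1 * s' := by
    apply mul_left_cancel₀ (pow_ne_zero a hp.ne_zero)
    rw [← hdet, ← pow_add, Nat.add_sub_cancel' hak]
  set e := α * z 0 1 + β * z 1 1 with he
  obtain ⟨c, hc⟩ := Ideal.mem_span_singleton.mp (PadicInt.appr_spec (k - a) e)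
  refine ⟨a, hak, e.appr (k - a), e.appr_lt _,
    ⟨!![x', x' * c - β; s', s' * c + α], ?_⟩, ?_⟩
  · rw [Matrix.det_fin_two_of]
    linear_combination hαβ
  · have h01 : z 0 1 = x' * (e.appr (k - a)) + (x' * c - β) * (p : ℤ_[p]) ^ (k - a) := by
      linear_combination (-z 0 1) * hαβ + x' * hc + x' * he + β * hD
    have h11 : z 1 1 = s' * (e.appr (k - a)) + (s' * c + α) * (p : ℤ_[p]) ^ (k - a) := by
      linear_combination (-z 1 1) * hαβ + s' * hc + s' * he - α * hD
    ext i j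
    fin_cases i <;> fin_cases j <;> simp [Matrix.mul_apply, Fin.sum_univ_two]
    · rw [hx, mul_comm]
    · exact h01
    · rw [hs, mul_comm]
    · exact h11

/-- Hermite normal forms in the same left `SL(2, ℤ_[p])`-orbit have the same parameters. -/
theorem PadicInt.hermite_form_unique {p : ℕ} [Fact p.Prime] {k a b a' b' : ℕ}
    (hb : b < p ^ (k - a)) (hb' : b' < p ^ (k - a')) (v : SL(2, ℤ_[p]))
    (h : (v : Matrix (Fin 2) (Fin 2) ℤ_[p]) *
        !![(p : ℤ_[p]) ^ a, (b : ℤ_[p]); 0, (p : ℤ_[p]) ^ (k - a)] =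
      !![(p : ℤ_[p]) ^ a', (b' : ℤ_[p]); 0, (p : ℤ_[p]) ^ (k - a')]) :
    a = a' ∧ b = b' := by
  have hp : Prime (p : ℤ_[p]) := PadicInt.prime_p
  have hpa : (p : ℤ_[p]) ^ a ≠ 0 := pow_ne_zero a hp.ne_zero
  have hdet := v.det_coe
  rw [Matrix.det_fin_two] at hdet
  have h00 := congrFun₂ h 0 0
  have h01 := congrFun₂ h 0 1
  have h10 := congrFun₂ h 1 0
  simp only [Matrix.mul_apply, Fin.sum_univ_two, Matrix.of_apply, Matrix.cons_val',
    Matrix.cons_val_zero, Matrix.cons_val_one, Matrix.cons_val_fin_one, mul_zero, add_zero] at h00 h01 h10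
  have hv10 : v 1 0 = 0 := (mul_eq_zero.mp h10).resolve_right hpa
  rw [hv10, mul_zero, sub_zero] at hdet
  have haa' : a = a' := by
    apply le_antisymm <;> rw [← pow_dvd_pow_iff hp.ne_zero hp.not_isUnit]
    · exact ⟨v 0 0, by rw [← h00, mul_comm]⟩
    · exact ⟨v 1 1, by linear_combination (-(p : ℤ_[p]) ^ a) * hdet + v 1 1 * h00⟩
  subst haa'
  have hv00 : v 0 0 = 1 := mul_right_cancel₀ hpa (by rw [h00, one_mul])
  rw [hv00, one_mul] at h01
  refine ⟨rfl, Nat.ModEq.eq_of_lt_of_lt (Nat.modEq_iff_dvd.mpr ?_) hb hb'⟩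
  have hdvd : (p : ℤ_[p]) ^ (k - a) ∣ ((b' - b : ℤ) : ℤ_[p]) :=
    ⟨v 0 1, by push_cast; linear_combination -h01⟩
  exact_mod_cast (PadicInt.pow_p_dvd_int_iff _ _).mp hdvd

/-- Every 2×2 matrix over `ℤ_[p]` of determinant `p^k` is uniquely `u · !![p^a, b; 0, p^(k−a)]`
with `u ∈ SL(2, ℤ_[p])`, `a ≤ k`, `b < p^(k−a)`; consequently the number of left
`SL(2,ℤ_[p])`-orbits on such matrices is `1 + p + ⋯ + p^k`. -/
theorem stmt_2 (p : ℕ) [Fact p.Prime] (k : ℕ) :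
    (∀ z : Matrix (Fin 2) (Fin 2) ℤ_[p], z.det = (p : ℤ_[p]) ^ k →
      ∃! w : ℕ × ℕ × SL(2, ℤ_[p]), w.1 ≤ k ∧ w.2.1 < p ^ (k - w.1) ∧
        z = (w.2.2 : Matrix (Fin 2) (Fin 2) ℤ_[p]) *
          !![(p : ℤ_[p]) ^ w.1, (w.2.1 : ℤ_[p]); 0, (p : ℤ_[p]) ^ (k - w.1)]) ∧
    Nat.card (MulAction.orbitRel.Quotient SL(2, ℤ_[p])
        {z : Matrix (Fin 2) (Fin 2) ℤ_[p] // z.det = (p : ℤ_[p]) ^ k}) =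
      ∑ i ∈ Finset.range (k + 1), p ^ i := by
  have hp : (p : ℤ_[p]) ≠ 0 := PadicInt.prime_p.ne_zero
  refine ⟨fun z hz => ?_, ?_⟩
  · obtain ⟨a, ha, b, hb, u, hu⟩ := PadicInt.exists_hermite_form hz
    refine ⟨(a, b, u), ⟨ha, hb, hu⟩, ?_⟩
    rintro ⟨a', b', u'⟩ ⟨-, hb', hu'⟩
    dsimp only at hb' hu'
    obtain ⟨rfl, rfl⟩ := PadicInt.hermite_form_unique hb' hb (u⁻¹ * u') (by
      rw [Matrix.SpecialLinearGroup.coe_mul, Matrix.mul_assoc, ← hu', hu, ← Matrix.mul_assoc,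
        ← Matrix.SpecialLinearGroup.coe_mul, inv_mul_cancel, Matrix.SpecialLinearGroup.coe_one,
        Matrix.one_mul])
    have hreg : (!![(p : ℤ_[p]) ^ a', (b' : ℤ_[p]); 0, (p : ℤ_[p]) ^ (k - a')]).det ≠ 0 := by
      rw [Matrix.det_fin_two_of, mul_zero, sub_zero]
      exact mul_ne_zero (pow_ne_zero _ hp) (pow_ne_zero _ hp)
    have huu' : u' = u := Subtype.ext <|
      (Matrix.isRegular_of_isLeftRegular_det (IsRegular.of_ne_zero hreg).left).right
        (hu'.symm.trans hu)
    rw [huu']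
  · let F : (Σ a : Fin (k + 1), Fin (p ^ (k - a))) →
        MulAction.orbitRel.Quotient SL(2, ℤ_[p])
          {z : Matrix (Fin 2) (Fin 2) ℤ_[p] // z.det = (p : ℤ_[p]) ^ k} := fun w =>
      Quotient.mk'' ⟨!![(p : ℤ_[p]) ^ (w.1 : ℕ), ((w.2 : ℕ) : ℤ_[p]);
          0, (p : ℤ_[p]) ^ (k - w.1)], by
        rw [Matrix.det_fin_two_of, mul_zero, sub_zero, ← pow_add,
          Nat.add_sub_cancel' (Nat.lt_succ_iff.mp w.1.2)]⟩
    have hF : F.Bijective := by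
      constructor
      · rintro ⟨⟨a, ha⟩, ⟨b, hb⟩⟩ ⟨⟨a', ha'⟩, ⟨b', hb'⟩⟩ h
        obtain ⟨v, hv⟩ := MulAction.orbitRel_apply.mp (Quotient.exact h)
        obtain ⟨rfl, rfl⟩ := PadicInt.hermite_form_unique hb' hb v (congrArg Subtype.val hv)
        rfl
      · intro q
        induction q using Quotient.inductionOn' with | _ z
        obtain ⟨a, ha, b, hb, u, hu⟩ := PadicInt.exists_hermite_form z.2
        refine ⟨⟨⟨a, Nat.lt_succ_iff.mpr ha⟩, ⟨b, hb⟩⟩, Eq.symm (Quotient.sound ?_)⟩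
        exact MulAction.orbitRel_apply.mpr ⟨u, Subtype.ext hu.symm⟩
    rw [← Nat.card_eq_of_bijective F hF, Nat.card_eq_fintype_card, Fintype.card_sigma]
    simp only [Fintype.card_fin]
    rw [Fin.sum_univ_eq_sum_range (fun i => p ^ (k - i)) (k + 1)]
    simpa using Finset.sum_range_reflect (fun i => p ^ i) (k + 1)
end

section
/- For every positive integer n, the number of orbits of the left-multiplication action of SL(2, ℤ) on the set {A ∈ M₂(ℤ) : det A = n} of 2×2 integer matrices of determinant n equals σ(n), the sum of the positive divisors of n. -/
open scoped MatrixGroups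

/-- The left-multiplication action of `SL(2, ℤ)` on 2×2 integer matrices of determinant `n`. -/
instance stmt3Action (n : ℕ) :
    MulAction SL(2, ℤ) {A : Matrix (Fin 2) (Fin 2) ℤ // A.det = (n : ℤ)} where
  smul u A := ⟨(u : Matrix (Fin 2) (Fin 2) ℤ) * A.1, by
    rw [Matrix.det_mul, Matrix.SpecialLinearGroup.det_coe, one_mul, A.2]⟩
  one_smul A := Subtype.ext (by
    show ((1 : SL(2, ℤ)) : Matrix (Fin 2) (Fin 2) ℤ) * A.1 = A.1
    simp)
  mul_smul u v A := Subtype.ext (by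
    show ((u * v : SL(2, ℤ)) : Matrix (Fin 2) (Fin 2) ℤ) * A.1 =
      (u : Matrix (Fin 2) (Fin 2) ℤ) * ((v : Matrix (Fin 2) (Fin 2) ℤ) * A.1)
    simp [Matrix.mul_assoc])

lemma coe_stmt3Action_smul {n : ℕ} (u : SL(2, ℤ))
    (A : {A : Matrix (Fin 2) (Fin 2) ℤ // A.det = (n : ℤ)}) :
    (u • A).1 = (u : Matrix (Fin 2) (Fin 2) ℤ) * A.1 := rfl

/-- Every integer matrix of nonzero determinant has a Hermite normal form. -/
lemma exists_SL2Z_mul_eq_upperTriangular {m : ℤ} (hm : m ≠ 0) (A : FixedDetMatrix (Fin 2) ℤ m) :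
    ∃ (u : SL(2, ℤ)) (a b d : ℤ), 0 < a ∧ 0 ≤ b ∧ b < |d| ∧
      (u : Matrix (Fin 2) (Fin 2) ℤ) * A.1 = !![a, b; 0, d] := by
  have key : ∀ (s : SL(2, ℤ)) (B : FixedDetMatrix (Fin 2) ℤ m),
      (∃ (u : SL(2, ℤ)) (a b d : ℤ), 0 < a ∧ 0 ≤ b ∧ b < |d| ∧
        (u : Matrix (Fin 2) (Fin 2) ℤ) * B.1 = !![a, b; 0, d]) →
      ∃ (u : SL(2, ℤ)) (a b d : ℤ), 0 < a ∧ 0 ≤ b ∧ b < |d| ∧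
        (u : Matrix (Fin 2) (Fin 2) ℤ) * (s • B).1 = !![a, b; 0, d] := by
    rintro s B ⟨u, a, b, d, ha, hb, hd, h⟩
    refine ⟨u * s⁻¹, a, b, d, ha, hb, hd, ?_⟩
    rw [FixedDetMatrices.smul_coe, ← mul_assoc, ← Matrix.SpecialLinearGroup.coe_mul,
      inv_mul_cancel_right, h]
  induction A using FixedDetMatrices.induction_on hm with
  | h0 A h10 h00 h01 h11 =>
    refine ⟨1, A.1 0 0, A.1 0 1, A.1 1 1, h00, h01, (le_abs_self _).trans_lt h11, ?_⟩
    rw [Matrix.SpecialLinearGroup.coe_one, one_mul, ← h10]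
    exact Matrix.eta_fin_two A.1
  | hS B hB => exact key _ B hB
  | hT B hB => exact key _ B hB

/-- A Hermite normal form is unique in its left `SL(2, ℤ)`-orbit. -/
lemma upperTriangular_eq_of_SL2Z_mul_eq {u : SL(2, ℤ)} {a b d a' b' d' : ℤ}
    (ha : 0 < a) (ha' : 0 < a') (hb : 0 ≤ b) (hbd : b < d) (hb' : 0 ≤ b') (hbd' : b' < d')
    (h : (u : Matrix (Fin 2) (Fin 2) ℤ) * !![a, b; 0, d] = !![a', b'; 0, d']) :
    b = b' ∧ d = d' := by
  have hu := u.det_coe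
  rw [Matrix.det_fin_two] at hu
  have h00 := congrFun₂ h 0 0
  have h01 := congrFun₂ h 0 1
  have h10 := congrFun₂ h 1 0
  have h11 := congrFun₂ h 1 1
  simp only [Matrix.mul_apply, Fin.sum_univ_two, Matrix.of_apply, Matrix.cons_val',
    Matrix.cons_val_zero, Matrix.cons_val_one, Matrix.cons_val_fin_one, mul_zero,
    add_zero] at h00 h01 h10 h11
  have hr : u 1 0 = 0 := (mul_eq_zero.mp h10).resolve_right ha.ne'
  rw [hr, mul_zero, sub_zero] at hu
  have hp : 0 < u 0 0 := pos_of_mul_pos_left (h00 ▸ ha') ha.le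
  have hp1 : u 0 0 = 1 := Int.eq_one_of_mul_eq_one_right hp.le hu
  rw [hp1, one_mul] at hu
  rw [hr, hu, zero_mul, zero_add, one_mul] at h11
  subst h11
  rw [hp1, one_mul] at h01
  refine ⟨?_, rfl⟩
  rw [← Int.emod_eq_of_lt hb hbd, ← Int.emod_eq_of_lt hb' hbd', ← h01, Int.add_mul_emod_self_right]

/-- The orbit of the matrix `!![n / d, b; 0, d]` for a divisor `d` of `n` and `b < d`. -/
def hermiteOrbit (n : ℕ) (x : Σ d : n.divisors, Fin d) :
    MulAction.orbitRel.Quotient SL(2, ℤ)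
      {A : Matrix (Fin 2) (Fin 2) ℤ // A.det = (n : ℤ)} :=
  Quotient.mk'' ⟨!![((n / x.1 : ℕ) : ℤ), ((x.2 : ℕ) : ℤ); 0, ((x.1 : ℕ) : ℤ)], by
    rw [Matrix.det_fin_two_of, mul_zero, sub_zero, ← Nat.cast_mul,
      Nat.div_mul_cancel (Nat.dvd_of_mem_divisors x.1.2)]⟩

lemma hermiteOrbit_injective (n : ℕ) : Function.Injective (hermiteOrbit n) := by
  rintro ⟨⟨d, hd⟩, b⟩ ⟨⟨d', hd'⟩, b'⟩ h
  obtain ⟨u, hu⟩ := MulAction.orbitRel_apply.mp (Quotient.eq''.mp h)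
  have hu := congrArg Subtype.val hu
  have hpos : ∀ e ∈ n.divisors, 0 < ((n / e : ℕ) : ℤ) := fun e he =>
    Nat.cast_pos.mpr (Nat.div_pos (Nat.divisor_le he) (Nat.pos_of_mem_divisors he))
  obtain ⟨hb, hdd⟩ := upperTriangular_eq_of_SL2Z_mul_eq (hpos d' hd') (hpos d hd)
    (Int.natCast_nonneg _) (Nat.cast_lt.mpr b'.2) (Int.natCast_nonneg _)
    (Nat.cast_lt.mpr b.2) hu
  obtain rfl : d' = d := Nat.cast_injective hdd
  obtain rfl : b' = b := Fin.ext (Nat.cast_injective hb)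
  rfl

lemma hermiteOrbit_surjective {n : ℕ} (hn : 0 < n) : Function.Surjective (hermiteOrbit n) := by
  intro q
  induction q using Quotient.inductionOn' with | h A
  obtain ⟨u, a, b, d, ha, hb, hbd, h⟩ :=
    exists_SL2Z_mul_eq_upperTriangular (Nat.cast_ne_zero.mpr hn.ne') A
  have hdet : a * d = n := by
    rw [← A.2, ← one_mul A.1.det, ← u.det_coe, ← Matrix.det_mul, h, Matrix.det_fin_two_of,
      mul_zero, sub_zero]
  have hd : 0 < d := pos_of_mul_pos_right (hdet ▸ Nat.cast_pos.mpr hn) ha.le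
  rw [abs_of_pos hd] at hbd
  lift a to ℕ using ha.le
  lift b to ℕ using hb
  lift d to ℕ using hd.le
  norm_cast at hdet hd hbd
  refine ⟨⟨⟨d, Nat.mem_divisors.mpr ⟨⟨a, by rw [← hdet, mul_comm]⟩, hn.ne'⟩⟩, ⟨b, hbd⟩⟩,
    Quotient.sound' (MulAction.orbitRel_apply.mpr ⟨u, Subtype.ext ?_⟩)⟩
  simp only [coe_stmt3Action_smul]
  rw [h, ← hdet, Nat.mul_div_cancel _ hd]

/-- For every positive integer `n`, the number of left `SL(2,ℤ)`-orbits on the set of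
2×2 integer matrices of determinant `n` equals `σ(n)`, the sum of the divisors of `n`. -/
theorem stmt_3 (n : ℕ) (hn : 0 < n) :
    Nat.card (MulAction.orbitRel.Quotient SL(2, ℤ)
        {A : Matrix (Fin 2) (Fin 2) ℤ // A.det = (n : ℤ)}) =
      ArithmeticFunction.sigma 1 n := by
  rw [← Nat.card_eq_of_bijective (hermiteOrbit n)
    ⟨hermiteOrbit_injective n, hermiteOrbit_surjective hn⟩, Nat.card_eq_fintype_card,
    Fintype.card_sigma, ArithmeticFunction.sigma_one_apply]
  simp only [Fintype.card_fin]
  exact Finset.sum_coe_sort n.divisors fun d => d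
end

section
/- Let m and n be coprime positive integers. Suppose (αᵢ)_{i∈I} is a family of 2×2 integer matrices of determinant m such that every integer matrix of determinant m equals u·αᵢ for a unique pair (u, i) with u ∈ SL(2, ℤ), and (βⱼ)_{j∈J} is a family of integer matrices of determinant n with the analogous property. Then every 2×2 integer matrix of determinant m·n can be written as u·αᵢ·βⱼ for a unique triple (u, i, j) with u ∈ SL(2, ℤ), i ∈ I, j ∈ J. -/
open scoped MatrixGroups

namespace Matrix

/-- A `2 × 2` integer matrix with nonzero determinant is left-equivalent under `SL(2, ℤ)` to an
upper triangular one. -/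
lemma exists_eq_SL_mul_upper_triangular (A : Matrix (Fin 2) (Fin 2) ℤ) (hA : A.det ≠ 0) :
    ∃ (u : SL(2, ℤ)) (a b d : ℤ),
      A = (u : Matrix (Fin 2) (Fin 2) ℤ) * !![a, b; 0, d] := by
  have hg : 0 < Int.gcd (A 0 0) (A 1 0) := by
    rw [Nat.pos_iff_ne_zero]
    intro h
    obtain ⟨h0, h1⟩ := Int.gcd_eq_zero_iff.mp h
    exact hA (by rw [det_fin_two, h0, h1]; ring)
  obtain ⟨p, r, hpr, hp, hr⟩ := Int.exists_gcd_one hg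
  obtain ⟨s, t, hst⟩ := Int.isCoprime_iff_gcd_eq_one.mpr hpr
  refine ⟨⟨!![p, -t; r, s], ?_⟩, Int.gcd (A 0 0) (A 1 0), s * A 0 1 + t * A 1 1,
    p * A 1 1 - r * A 0 1, ?_⟩
  · rw [det_fin_two_of]
    linear_combination hst
  · ext i j
    fin_cases i <;> fin_cases j <;> simp [mul_apply, Fin.sum_univ_two]
    · linear_combination hp
    · linear_combination (-A 0 1) * hst
    · linear_combination hr
    · linear_combination (-A 1 1) * hst

/-- A `2 × 2` integer matrix of nonzero determinant `m * n`, with `m` and `n` coprime, is a product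
of matrices of determinants `m` and `n`. -/
lemma exists_eq_mul_of_det_eq_mul {m n : ℤ} (hmn : IsCoprime m n) (h0 : m * n ≠ 0)
    (A : Matrix (Fin 2) (Fin 2) ℤ) (hA : A.det = m * n) :
    ∃ C B : Matrix (Fin 2) (Fin 2) ℤ, C.det = m ∧ B.det = n ∧ A = C * B := by
  obtain ⟨u, a, b, d, rfl⟩ := exists_eq_SL_mul_upper_triangular A (hA ▸ h0)
  have had : a * d = m * n := by
    simpa [det_mul, det_fin_two_of] using hA
  obtain ⟨a₁, a₂, ⟨m', rfl⟩, ⟨n', rfl⟩, rfl⟩ := exists_dvd_and_dvd_of_dvd_mul ⟨d, had.symm⟩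
  have ha : a₁ * a₂ ≠ 0 := fun h => h0 (by linear_combination m' * n' * h)
  have hd : d = m' * n' := mul_left_cancel₀ ha (by linear_combination had)
  obtain ⟨s, t, hst⟩ := hmn.of_mul_left_left.of_mul_right_right
  refine ⟨u * !![a₁, b * t; 0, m'], !![a₂, b * s; 0, n'], ?_, ?_, ?_⟩
  · simp [det_mul, det_fin_two_of]
  · simp [det_fin_two_of]
  · rw [mul_assoc]
    congr 1
    ext i j
    fin_cases i <;> fin_cases j <;> simp [mul_apply, Fin.sum_univ_two]
    · linear_combination (-b) * hst
    · exact hd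

/-- If `C * B = C' * B'` with `det C = det C' = m` and `det B = det B' = n` coprime, then `B` and
`B'` lie in the same left `SL`-orbit. -/
lemma exists_eq_SL_mul_of_mul_eq_mul {ι : Type*} [Fintype ι] [DecidableEq ι] {m n : ℤ}
    (hmn : IsCoprime m n) (hn : n ≠ 0) {C C' B B' : Matrix ι ι ℤ} (hC' : C'.det = m)
    (hB : B.det = n) (hB' : B'.det = n) (h : C * B = C' * B') :
    ∃ u : SpecialLinearGroup ι ℤ, B' = (u : Matrix ι ι ℤ) * B := by
  have key : n • (C'.adjugate * C) = m • (B' * B.adjugate) := by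
    calc n • (C'.adjugate * C) = C'.adjugate * (C * B) * B.adjugate := by
          rw [← mul_assoc C'.adjugate, mul_assoc (C'.adjugate * C), mul_adjugate, hB,
            Matrix.mul_smul, mul_one]
      _ = m • (B' * B.adjugate) := by
          rw [h, ← mul_assoc C'.adjugate, adjugate_mul, hC', smul_mul, one_mul, smul_mul]
  have hdvd : ∀ i j, ∃ c, (B' * B.adjugate) i j = n * c := fun i j =>
    hmn.symm.dvd_of_dvd_mul_left
      ⟨(C'.adjugate * C) i j, by simpa using (congrFun₂ key i j).symm⟩
  choose U hU using hdvd
  have hX : B' * B.adjugate = n • of U := by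
    ext i j
    simpa using hU i j
  have hUB : B' = of U * B := by
    have : n • B' = n • (of U * B) := by
      rw [← smul_mul, ← hX, mul_assoc, adjugate_mul, hB, Matrix.mul_smul, mul_one]
    exact smul_right_injective _ hn this
  refine ⟨⟨of U, ?_⟩, hUB⟩
  have hdet := congrArg det hUB
  rw [det_mul, hB, hB'] at hdet
  exact mul_right_cancel₀ hn (by rw [← hdet, one_mul])

end Matrix

/-- If `(αᵢ)` and `(βⱼ)` are complete systems of representatives for the left `SL(2,ℤ)`-orbits
on 2×2 integer matrices of determinant `m`, respectively `n`, with `m, n` coprime, then every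
integer matrix of determinant `m·n` is `u·αᵢ·βⱼ` for a unique triple `(u, i, j)`. -/
theorem stmt_4 (m n : ℕ) (hm : 0 < m) (hn : 0 < n) (hmn : Nat.Coprime m n)
    {I J : Type*} (α : I → Matrix (Fin 2) (Fin 2) ℤ) (β : J → Matrix (Fin 2) (Fin 2) ℤ)
    (hα : ∀ i, (α i).det = (m : ℤ)) (hβ : ∀ j, (β j).det = (n : ℤ))
    (hαrep : ∀ A : Matrix (Fin 2) (Fin 2) ℤ, A.det = (m : ℤ) →
      ∃! w : SL(2, ℤ) × I, A = (w.1 : Matrix (Fin 2) (Fin 2) ℤ) * α w.2)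
    (hβrep : ∀ A : Matrix (Fin 2) (Fin 2) ℤ, A.det = (n : ℤ) →
      ∃! w : SL(2, ℤ) × J, A = (w.1 : Matrix (Fin 2) (Fin 2) ℤ) * β w.2) :
    ∀ A : Matrix (Fin 2) (Fin 2) ℤ, A.det = (m : ℤ) * n →
      ∃! w : SL(2, ℤ) × I × J,
        A = (w.1 : Matrix (Fin 2) (Fin 2) ℤ) * α w.2.1 * β w.2.2 := by
  have hmn' : IsCoprime (m : ℤ) n := Nat.isCoprime_iff_coprime.mpr hmn
  have hn' : (n : ℤ) ≠ 0 := by exact_mod_cast hn.ne'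
  have hm' : (m : ℤ) ≠ 0 := by exact_mod_cast hm.ne'
  intro A hA
  obtain ⟨C, B, hC, hB, rfl⟩ :=
    Matrix.exists_eq_mul_of_det_eq_mul hmn' (mul_ne_zero hm' hn') A hA
  obtain ⟨⟨v, j⟩, rfl : B = v * β j, -⟩ := hβrep B hB
  obtain ⟨⟨u, i⟩, hCv : C * v = u * α i, huniq⟩ := hαrep (C * v) (by simp [hC])
  refine ⟨(u, i, j), by rw [← mul_assoc, hCv], ?_⟩
  rintro ⟨u', i', j'⟩ (h : C * (v * β j) = u' * α i' * β j')
  rw [← mul_assoc] at h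
  obtain ⟨w, hw⟩ := Matrix.exists_eq_SL_mul_of_mul_eq_mul hmn' hn'
    (C' := (u' : Matrix (Fin 2) (Fin 2) ℤ) * α i') (by simp [hα]) (hβ j) (hβ j') h
  obtain rfl : j' = j := congrArg Prod.snd <|
    (hβrep (β j') (hβ j')).unique (y₁ := (1, j')) (y₂ := (w, j)) (by simp) hw
  have hreg : IsRightRegular (β j') :=
    (Matrix.isRegular_of_isLeftRegular_det
      (IsLeftCancelMulZero.mul_left_cancel_of_ne_zero (by rw [hβ]; exact hn'))).right
  have hui := huniq (u', i') (hreg h)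
  rw [Prod.ext_iff] at hui
  exact Prod.ext hui.1 (Prod.ext hui.2 rfl)
end

section
/- Let p be an odd prime, let D be a positive integer that is not a perfect square, and let T, U be integers with U ≠ 0 and T² − D·U² = 4. Write V(i) := ((⟨T, U⟩ : ℤ[√D])^i).im. Then the set S = {i ≥ 1 : p ∣ V(i)} is nonempty, and its least element e₁ divides p − legendreSym p D (where legendreSym p D, the Legendre symbol, equals 0 when p ∣ D). -/
namespace Zsqrtd

variable {D : ℤ} {p : ℕ}

/-- If `p` divides the imaginary part of `a`, it divides that of every power of `a`. -/
theorem dvd_im_pow {a : ℤ√D} (ha : (p : ℤ) ∣ a.im) (k : ℕ) : (p : ℤ) ∣ (a ^ k).im := by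
  induction k with
  | zero => simp
  | succ k ih =>
    rw [pow_succ, im_mul]
    exact dvd_add (ha.mul_left _) (ih.mul_right _)

/-- An element whose norm is prime to `p` and whose imaginary part vanishes modulo `p` can be
cancelled when testing whether `p` divides the imaginary part of a product. -/
theorem dvd_im_of_dvd_im_mul (hp : p.Prime) {a b : ℤ√D} (hn : ¬ (p : ℤ) ∣ a.norm)
    (ha : (p : ℤ) ∣ a.im) (hab : (p : ℤ) ∣ (a * b).im) : (p : ℤ) ∣ b.im := by
  rw [im_mul] at hab
  have hmul : (p : ℤ) ∣ a.re * b.im := (dvd_add_left (ha.mul_right _)).mp hab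
  refine ((Nat.prime_iff_prime_int.mp hp).dvd_or_dvd hmul).resolve_left fun hre => hn ?_
  rw [norm_def]
  exact dvd_sub (hre.mul_right _) (ha.mul_left _)

/-- The least positive exponent for which `p` divides the imaginary part of the power divides every
such exponent. -/
theorem isLeast_dvd_of_dvd_im_pow (hp : p.Prime) {a : ℤ√D} (hn : ¬ (p : ℤ) ∣ a.norm) {e n : ℕ}
    (he : IsLeast {i : ℕ | 1 ≤ i ∧ (p : ℤ) ∣ (a ^ i).im} e) (h : (p : ℤ) ∣ (a ^ n).im) :
    e ∣ n := by
  obtain ⟨⟨he1, hepow⟩, hmin⟩ := he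
  by_contra hne
  have hmod : (p : ℤ) ∣ (a ^ (n % e)).im := by
    refine dvd_im_of_dvd_im_mul hp (a := (a ^ e) ^ (n / e)) ?_ (dvd_im_pow hepow _) ?_
    · have hnorm : ((a ^ e) ^ (n / e)).norm = a.norm ^ (e * (n / e)) := by
        rw [← pow_mul]
        exact map_pow (normMonoidHom (d := D)) a _
      rw [hnorm]
      exact fun hdvd => hn ((Nat.prime_iff_prime_int.mp hp).dvd_of_dvd_pow hdvd)
    · rwa [← pow_mul, ← pow_add, Nat.div_add_mod]
  have hle := hmin ⟨Nat.pos_of_ne_zero fun h0 => hne (Nat.dvd_of_mod_eq_zero h0), hmod⟩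
  exact absurd (Nat.mod_lt n he1) (not_lt.mpr hle)

/-- Frobenius modulo an odd prime `p`: it fixes the rational part and multiplies `√D` by the
Legendre symbol. -/
theorem exists_pow_prime_eq [Fact p.Prime] (hodd : Odd p) (a : ℤ√D) :
    ∃ r : ℤ√D, a ^ p = ⟨a.re, legendreSym p D * a.im⟩ + (p : ℤ√D) * r := by
  have hp : p.Prime := Fact.out
  obtain ⟨r, hr⟩ := exists_add_pow_prime_eq hp (a.re : ℤ√D) (sqrtd * (a.im : ℤ√D))
  have hre : (p : ℤ) ∣ a.re ^ p - a.re := by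
    rw [← ZMod.intCast_zmod_eq_zero_iff_dvd]
    simp [ZMod.pow_card]
  have him : (p : ℤ) ∣ D ^ (p / 2) * a.im ^ p - legendreSym p D * a.im := by
    rw [← ZMod.intCast_zmod_eq_zero_iff_dvd]
    simp [ZMod.pow_card, legendreSym.eq_pow]
  obtain ⟨s, hs⟩ := hre
  obtain ⟨t, ht⟩ := him
  have hsqrt : (sqrtd : ℤ√D) ^ p = sqrtd * ((D ^ (p / 2) : ℤ) : ℤ√D) := by
    conv_lhs => rw [← Nat.two_mul_div_two_add_one_of_odd hodd]
    rw [pow_succ, pow_mul, sq, dmuld]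
    push_cast
    ring
  refine ⟨(a.re : ℤ√D) * (sqrtd * (a.im : ℤ√D)) * r + (⟨s, t⟩ : ℤ√D), ?_⟩
  have hdecomp (x y : ℤ) : (⟨x, y⟩ : ℤ√D) = (x : ℤ√D) + sqrtd * (y : ℤ√D) := decompose
  have hs' := congrArg (Int.cast : ℤ → ℤ√D) hs
  have ht' := congrArg (Int.cast : ℤ → ℤ√D) ht
  have ha : a = (a.re : ℤ√D) + sqrtd * (a.im : ℤ√D) := hdecomp a.re a.im
  conv_lhs => rw [ha]
  rw [hr, mul_pow, hsqrt, hdecomp, hdecomp]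
  push_cast at hs' ht' ⊢
  linear_combination hs' + sqrtd * ht'

/-- For an element of norm prime to the odd prime `p`, the power with exponent
`p - legendreSym p D` has imaginary part divisible by `p`. -/
theorem exists_dvd_im_pow_sub_legendreSym [Fact p.Prime] (hodd : Odd p) {a : ℤ√D}
    (hn : ¬ (p : ℤ) ∣ a.norm) :
    ∃ n : ℕ, 1 ≤ n ∧ (n : ℤ) = p - legendreSym p D ∧ (p : ℤ) ∣ (a ^ n).im := by
  have hp : p.Prime := Fact.out
  obtain ⟨r, hr⟩ := exists_pow_prime_eq hodd a
  have hdvd (s : ℤ√D) : (p : ℤ) ∣ ((p : ℤ√D) * s).im := by simp [im_mul]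
  by_cases h0 : (D : ZMod p) = 0
  · have hleg := (legendreSym.eq_zero_iff p D).mpr h0
    refine ⟨p, hp.one_le, by simp [hleg], ?_⟩
    rw [hr, hleg, im_add]
    simp
  rcases legendreSym.eq_one_or_neg_one p h0 with hleg | hleg
  · refine ⟨p - 1, Nat.sub_pos_of_lt hp.one_lt, by simp [hleg, hp.one_le], ?_⟩
    have hmul : a.norm * (a ^ (p - 1)).im = ((p : ℤ√D) * (r * star a)).im := by
      have hpow : a ^ (p - 1) * a = a + p * r := by
        rw [pow_sub_one_mul hp.ne_zero, hr, hleg, one_mul]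
      have hkey : (a.norm : ℤ√D) * a ^ (p - 1) = (a.norm : ℤ√D) + p * (r * star a) := by
        rw [norm_eq_mul_conj]
        linear_combination star a * hpow
      simpa using congrArg Zsqrtd.im hkey
    exact ((Nat.prime_iff_prime_int.mp hp).dvd_or_dvd (hmul ▸ hdvd _)).resolve_left hn
  · refine ⟨p + 1, by omega, by simp [hleg], ?_⟩
    have hstar : (⟨a.re, -1 * a.im⟩ : ℤ√D) = star a := by ext <;> simp
    have hkey : a ^ (p + 1) = (a.norm : ℤ√D) + p * (r * a) := by
      rw [pow_succ, hr, hleg, hstar, norm_eq_mul_conj]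
      ring
    rw [hkey, im_add, im_intCast, zero_add]
    exact hdvd _

end Zsqrtd


/-- Let `p` be an odd prime, `D` a positive non-square integer, and `T, U` integers with
`U ≠ 0` and `T² − D·U² = 4`. Then the set `S = {i ≥ 1 : p ∣ ((⟨T,U⟩ : ℤ√D)^i).im}` is
nonempty, and its least element divides `p − legendreSym p D`. -/
theorem stmt_6 (p : ℕ) [Fact p.Prime] (hodd : Odd p) (D : ℤ) (hD : 0 < D)
    (hsq : ¬ IsSquare D) (T U : ℤ) (hU : U ≠ 0) (h : T ^ 2 - D * U ^ 2 = 4) :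
    {i : ℕ | 1 ≤ i ∧ (p : ℤ) ∣ ((⟨T, U⟩ : ℤ√D) ^ i).im}.Nonempty ∧
    ∀ e₁ : ℕ, IsLeast {i : ℕ | 1 ≤ i ∧ (p : ℤ) ∣ ((⟨T, U⟩ : ℤ√D) ^ i).im} e₁ →
      (e₁ : ℤ) ∣ (p : ℤ) - legendreSym p D := by
  have hp : p.Prime := Fact.out
  have hnorm : (⟨T, U⟩ : ℤ√D).norm = 4 := by
    rw [Zsqrtd.norm_def]
    linear_combination h
  have hn : ¬ (p : ℤ) ∣ (⟨T, U⟩ : ℤ√D).norm := by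
    rw [hnorm]
    intro hdvd
    have hdvd' : p ∣ 2 ^ 2 := by exact_mod_cast hdvd
    have h2 := (Nat.prime_dvd_prime_iff_eq hp Nat.prime_two).mp (hp.dvd_of_dvd_pow hdvd')
    rw [h2] at hodd
    exact absurd hodd (by decide)
  obtain ⟨n, hn1, hn_eq, hdvd⟩ := Zsqrtd.exists_dvd_im_pow_sub_legendreSym hodd hn
  refine ⟨⟨n, hn1, hdvd⟩, fun e₁ he => ?_⟩
  rw [← hn_eq]
  exact_mod_cast Zsqrtd.isLeast_dvd_of_dvd_im_pow hp hn he hdvd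
end

section
/- Let p be an odd prime and let D, T, U be integers with T² − D·U² = 4 and legendreSym p D = 1 (i.e., p ∤ D and D is a nonzero square modulo p). Then p divides ((⟨T, U⟩ : ℤ[√D])^{(p−1)/2}).im. -/
/-- In a domain, if `x * y = z ^ 2` where `x` and `z` have `2 * k`-th power equal to `1`,
then `x ^ k = y ^ k`. -/
theorem pow_eq_pow_of_mul_eq_sq {R : Type*} [CommRing R] [IsDomain R] {x y z : R} {k : ℕ}
    (hxy : x * y = z ^ 2) (hx : x ^ (2 * k) = 1) (hz : z ^ (2 * k) = 1) : x ^ k = y ^ k := by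
  have hmul : x ^ k * y ^ k = 1 := by rw [← mul_pow, hxy, ← pow_mul, hz]
  have hsq : x ^ k * x ^ k = 1 := by rw [← pow_add, ← two_mul, hx]
  exact mul_left_cancel₀ (left_ne_zero_of_mul_eq_one hsq) (hsq.trans hmul.symm)

/-- Split case: if `p` is an odd prime, `T² − D·U² = 4` and `legendreSym p D = 1`,
then `p` divides the `im` component of `(⟨T, U⟩ : ℤ√D)^((p−1)/2)`. -/
theorem stmt_7 (p : ℕ) [Fact p.Prime] (hodd : Odd p) (D T U : ℤ)
    (h : T ^ 2 - D * U ^ 2 = 4) (hleg : legendreSym p D = 1) :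
    (p : ℤ) ∣ ((⟨T, U⟩ : ℤ√D) ^ ((p - 1) / 2)).im := by
  have hD : (D : ZMod p) ≠ 0 := fun h0 => by
    rw [(legendreSym.eq_zero_iff p D).2 h0] at hleg
    exact zero_ne_one hleg
  obtain ⟨r, hr⟩ := (legendreSym.eq_one_iff p hD).1 hleg
  have hr0 : r ≠ 0 := by
    rintro rfl
    exact hD (by simpa using hr)
  have h2 : (2 : ZMod p) ≠ 0 := by
    refine Ring.two_ne_zero ?_
    rw [ZMod.ringChar_zmod_n]
    rintro rfl
    exact absurd hodd (by decide)
  have hk : 2 * ((p - 1) / 2) = p - 1 := by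
    obtain ⟨m, rfl⟩ := hodd
    omega
  generalize (p - 1) / 2 = k at hk ⊢
  have hxy : ((T : ZMod p) + U * r) * (T + U * -r) = 2 ^ 2 := by
    have h' : (T : ZMod p) ^ 2 - D * U ^ 2 = 4 := by
      simpa using congrArg (Int.cast : ℤ → ZMod p) h
    linear_combination h' + (U : ZMod p) ^ 2 * hr
  have hx0 : (T : ZMod p) + U * r ≠ 0 :=
    left_ne_zero_of_mul (hxy ▸ pow_ne_zero 2 h2)
  have hpow := pow_eq_pow_of_mul_eq_sq (k := k) hxy
    (hk ▸ ZMod.pow_card_sub_one_eq_one hx0) (hk ▸ ZMod.pow_card_sub_one_eq_one h2)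
  have e₁ := map_pow (Zsqrtd.lift ⟨r, hr.symm⟩) (⟨T, U⟩ : ℤ√D) k
  have e₂ := map_pow (Zsqrtd.lift ⟨-r, by rw [neg_mul_neg, hr]⟩) (⟨T, U⟩ : ℤ√D) k
  simp only [Zsqrtd.lift_apply_apply] at e₁ e₂
  rw [← ZMod.intCast_zmod_eq_zero_iff_dvd]
  refine (mul_eq_zero.1 ?_).resolve_left (mul_ne_zero h2 hr0)
  linear_combination e₁ - e₂ + hpow
end

section
/- Let p be an odd prime and let D, T, U be integers with T² − D·U² = 4 and legendreSym p D = −1 (i.e., D is a non-square modulo p). Then p divides ((⟨T, U⟩ : ℤ[√D])^{p+1}).im. -/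
/-- Frobenius acts as conjugation on `ℤ√D` modulo an inert odd prime. -/
theorem Zsqrtd.natCast_dvd_pow_sub_star {p : ℕ} [Fact p.Prime] (hodd : Odd p) {D : ℤ}
    (hleg : legendreSym p D = -1) (z : ℤ√D) : (p : ℤ√D) ∣ z ^ p - star z := by
  obtain ⟨x, y⟩ := z
  have fermat (n : ℤ) : (p : ℤ) ∣ n ^ p - n := by
    rw [← ZMod.intCast_zmod_eq_zero_iff_dvd]
    simp
  have euler : (p : ℤ) ∣ D ^ (p / 2) + 1 := by
    rw [← ZMod.intCast_zmod_eq_zero_iff_dvd]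
    push_cast
    rw [← legendreSym.eq_pow, hleg]
    simp
  obtain ⟨a, ha⟩ := fermat x
  obtain ⟨b, hb⟩ := fermat y
  obtain ⟨c, hc⟩ := euler
  have ha' : (x : ℤ√D) ^ p = x + p * a := by exact_mod_cast eq_add_of_sub_eq' ha
  have hb' : (y : ℤ√D) ^ p = y + p * b := by exact_mod_cast eq_add_of_sub_eq' hb
  have hs : (sqrtd : ℤ√D) ^ p = ((p : ℤ√D) * (c : ℤ√D) - 1) * sqrtd := by
    have hc' : (D : ℤ√D) ^ (p / 2) = p * c - 1 := by exact_mod_cast eq_sub_of_add_eq hc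
    conv_lhs => rw [← Nat.two_mul_div_two_add_one_of_odd hodd]
    rw [pow_succ, pow_mul, sq, dmuld, hc']
  obtain ⟨r, hr⟩ := exists_add_pow_prime_eq (Fact.out : p.Prime) (x : ℤ√D) (sqrtd * (y : ℤ√D))
  have hstar : star (⟨x, y⟩ : ℤ√D) = (x : ℤ√D) - sqrtd * (y : ℤ√D) := by ext <;> simp
  rw [hstar, decompose, hr, mul_pow, ha', hb', hs]
  exact ⟨(a : ℤ√D) + sqrtd * (c * y + p * c * b - b : ℤ√D) + (x : ℤ√D) * (sqrtd * (y : ℤ√D)) * r,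
    by ring⟩

/-- Inert case: if `p` is an odd prime, `T² − D·U² = 4` and `legendreSym p D = −1`,
then `p` divides the `im` component of `(⟨T, U⟩ : ℤ√D)^(p+1)`. -/
theorem stmt_8 (p : ℕ) [Fact p.Prime] (hodd : Odd p) (D T U : ℤ)
    (h : T ^ 2 - D * U ^ 2 = 4) (hleg : legendreSym p D = -1) :
    (p : ℤ) ∣ ((⟨T, U⟩ : ℤ√D) ^ (p + 1)).im := by
  obtain ⟨r, hr⟩ := Zsqrtd.natCast_dvd_pow_sub_star hodd hleg ⟨T, U⟩
  rw [pow_succ, eq_add_of_sub_eq' hr, add_mul, mul_comm (star _), ← Zsqrtd.norm_eq_mul_conj,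
    mul_assoc]
  refine ⟨(r * ⟨T, U⟩).im, ?_⟩
  rw [Zsqrtd.im_add, Zsqrtd.im_intCast, zero_add, ← Int.cast_natCast (R := ℤ√D), Zsqrtd.im_smul]
end

section
/- Let p be an odd prime and let D, T, U be integers with T² − D·U² = 4 and p ∣ D. Then p divides ((⟨T, U⟩ : ℤ[√D])^{p}).im. -/
/-- Modulo `d`, the real part `ℤ√d → ℤ` commutes with powers. -/
theorem Zsqrtd.dvd_re_pow_sub {d : ℤ} (z : ℤ√d) (n : ℕ) : d ∣ (z ^ n).re - z.re ^ n := by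
  induction n with
  | zero => simp
  | succ n ih =>
    obtain ⟨c, hc⟩ := ih
    refine ⟨c * z.re + (z ^ n).im * z.im, ?_⟩
    rw [pow_succ, Zsqrtd.re_mul]
    linear_combination z.re * hc

/-- Modulo `d`, the imaginary part of a power in `ℤ√d` is given by the derivative of the power. -/
theorem Zsqrtd.dvd_im_pow_sub {d : ℤ} (z : ℤ√d) (n : ℕ) :
    d ∣ (z ^ n).im - n * z.re ^ (n - 1) * z.im := by
  cases n with
  | zero => simp
  | succ n =>
    rw [Nat.add_sub_cancel]
    induction n with
    | zero => simp
    | succ n ih =>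
      obtain ⟨b, hb⟩ := z.dvd_re_pow_sub (n + 1)
      obtain ⟨c, hc⟩ := ih
      refine ⟨b * z.im + c * z.re, ?_⟩
      rw [pow_succ z (n + 1), Zsqrtd.im_mul]
      push_cast at hc ⊢
      linear_combination z.im * hb + z.re * hc

/-- Ramified case: if `p` is an odd prime, `T² − D·U² = 4` and `p ∣ D`,
then `p` divides the `im` component of `(⟨T, U⟩ : ℤ√D)^p`. -/
theorem stmt_9 (p : ℕ) [Fact p.Prime] (hodd : Odd p) (D T U : ℤ)
    (h : T ^ 2 - D * U ^ 2 = 4) (hD : (p : ℤ) ∣ D) :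
    (p : ℤ) ∣ ((⟨T, U⟩ : ℤ√D) ^ p).im := by
  refine (dvd_iff_dvd_of_dvd_sub (hD.trans (Zsqrtd.dvd_im_pow_sub _ p))).mpr ?_
  rw [mul_assoc]
  exact dvd_mul_right _ _
end

section
/- Let p be an odd prime, let D be a positive integer that is not a perfect square, and let T, U be integers with U ≠ 0 and T² − D·U² = 4. Write V(i) := ((⟨T, U⟩ : ℤ[√D])^i).im, and suppose e₁ ≥ 1 satisfies p ∣ V(e₁) while p ∤ V(j) for all j with 1 ≤ j < e₁. Then for every i ≥ 1, p divides V(i) if and only if e₁ divides i. -/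
/-- Multiplying by an element of norm `4 ^ n` whose imaginary part is divisible by the odd prime `p`
does not change whether `p` divides the imaginary part. -/
theorem Zsqrtd.dvd_im_mul_iff_of_norm_eq_four_pow {p : ℕ} (hp : p.Prime) (hodd : Odd p) {D : ℤ}
    {x : ℤ√D} {n : ℕ} (hnorm : x.norm = 4 ^ n) (hx : (p : ℤ) ∣ x.im) (y : ℤ√D) :
    (p : ℤ) ∣ (x * y).im ↔ (p : ℤ) ∣ y.im := by
  have hpz : Prime (p : ℤ) := Nat.prime_iff_prime_int.mp hp
  have hre : ¬ (p : ℤ) ∣ x.re := by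
    intro hre
    have h4 : (p : ℤ) ∣ 4 ^ n := by
      rw [← hnorm, Zsqrtd.norm_def]
      exact dvd_sub (hre.mul_right _) (hx.mul_left _)
    have h2 : p ∣ 2 ^ 2 := by exact_mod_cast hpz.dvd_of_dvd_pow h4
    have hp2 : p = 2 := (Nat.prime_dvd_prime_iff_eq hp Nat.prime_two).mp (hp.dvd_of_dvd_pow h2)
    exact absurd hodd (by simp [hp2])
  rw [Zsqrtd.im_mul, dvd_add_left (hx.mul_right _), hpz.dvd_mul]
  exact or_iff_right hre

/-- An element whose imaginary part is divisible by `m` has powers with the same property. -/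
theorem Zsqrtd.dvd_im_pow_s10 {m D : ℤ} {x : ℤ√D} (hx : m ∣ x.im) (n : ℕ) : m ∣ (x ^ n).im := by
  induction n with
  | zero => simp
  | succ k ih =>
    rw [pow_succ, Zsqrtd.im_mul]
    exact dvd_add (hx.mul_left _) (ih.mul_right _)


/-- If `e₁` is the least positive index with `p ∣ V(e₁)` where `V(i) = ((⟨T,U⟩:ℤ√D)^i).im`,
then for every `i ≥ 1`, `p ∣ V(i)` if and only if `e₁ ∣ i`. -/
theorem stmt_10 (p : ℕ) [Fact p.Prime] (hodd : Odd p) (D : ℤ) (hD : 0 < D)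
    (hsq : ¬ IsSquare D) (T U : ℤ) (hU : U ≠ 0) (h : T ^ 2 - D * U ^ 2 = 4)
    (e₁ : ℕ) (he₁ : 1 ≤ e₁) (hdvd : (p : ℤ) ∣ ((⟨T, U⟩ : ℤ√D) ^ e₁).im)
    (hmin : ∀ j : ℕ, 1 ≤ j → j < e₁ → ¬ (p : ℤ) ∣ ((⟨T, U⟩ : ℤ√D) ^ j).im) :
    ∀ i : ℕ, 1 ≤ i → ((p : ℤ) ∣ ((⟨T, U⟩ : ℤ√D) ^ i).im ↔ e₁ ∣ i) := by
  intro i _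
  have hnorm (n : ℕ) : ((⟨T, U⟩ : ℤ√D) ^ n).norm = 4 ^ n := by
    have h1 : (⟨T, U⟩ : ℤ√D).norm = 4 := by
      rw [Zsqrtd.norm_def]
      linear_combination h
    rw [← h1]
    exact map_pow Zsqrtd.normMonoidHom _ n
  have hq : (p : ℤ) ∣ ((⟨T, U⟩ : ℤ√D) ^ (e₁ * (i / e₁))).im := by
    rw [pow_mul]
    exact Zsqrtd.dvd_im_pow_s10 hdvd _
  have hmod : (p : ℤ) ∣ ((⟨T, U⟩ : ℤ√D) ^ i).im ↔ (p : ℤ) ∣ ((⟨T, U⟩ : ℤ√D) ^ (i % e₁)).im := by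
    conv_lhs => rw [← Nat.div_add_mod i e₁, pow_add]
    exact Zsqrtd.dvd_im_mul_iff_of_norm_eq_four_pow Fact.out hodd (hnorm _) hq _
  rw [hmod, Nat.dvd_iff_mod_eq_zero]
  constructor
  · intro hr
    by_contra hne
    exact hmin _ (Nat.pos_of_ne_zero hne) (Nat.mod_lt _ he₁) hr
  · intro h0
    simp [h0]
end

section
/- Let p be an odd prime and let D, T, U be integers with T² − D·U² = 4, p ∤ U, and p² ∣ D. Then p divides ((⟨T, U⟩ : ℤ[√D])^{p}).im but p² does not divide ((⟨T, U⟩ : ℤ[√D])^{p}).im. -/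
/-- Modulo `D`, powers of `a + b√D` are given by the first two terms of the binomial expansion. -/
theorem Zsqrtd.pow_succ_re_im_modEq (D a b : ℤ) (n : ℕ) :
    ((⟨a, b⟩ : ℤ√D) ^ (n + 1)).re ≡ a ^ (n + 1) [ZMOD D] ∧
      ((⟨a, b⟩ : ℤ√D) ^ (n + 1)).im ≡ (n + 1) * a ^ n * b [ZMOD D] := by
  induction n with
  | zero => simp
  | succ n ih =>
    obtain ⟨hre, him⟩ := ih
    rw [pow_succ _ (n + 1), Zsqrtd.re_mul, Zsqrtd.im_mul]
    obtain ⟨r, hr⟩ := hre.symm.dvd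
    obtain ⟨s, hs⟩ := him.symm.dvd
    refine ⟨(Int.modEq_of_dvd ⟨a * r + ((⟨a, b⟩ : ℤ√D) ^ (n + 1)).im * b, ?_⟩).symm,
      (Int.modEq_of_dvd ⟨b * r + a * s, ?_⟩).symm⟩
    · linear_combination a * hr
    · push_cast
      linear_combination b * hr + a * hs

/-- If `p` is an odd prime, `T² − D·U² = 4`, `p ∤ U` and `p² ∣ D`, then `p` exactly divides
the `im` component of `(⟨T, U⟩ : ℤ√D)^p`. -/
theorem stmt_11 (p : ℕ) [Fact p.Prime] (hodd : Odd p) (D T U : ℤ)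
    (h : T ^ 2 - D * U ^ 2 = 4) (hU : ¬ (p : ℤ) ∣ U) (hD : (p : ℤ) ^ 2 ∣ D) :
    (p : ℤ) ∣ ((⟨T, U⟩ : ℤ√D) ^ p).im ∧ ¬ (p : ℤ) ^ 2 ∣ ((⟨T, U⟩ : ℤ√D) ^ p).im := by
  have hp : p.Prime := Fact.out
  have hpz : Prime (p : ℤ) := Nat.prime_iff_prime_int.mp hp
  have hT : ¬ (p : ℤ) ∣ T := by
    intro hpT
    have hpD : (p : ℤ) ∣ D := (dvd_pow_self _ two_ne_zero).trans hD
    have h4 : (p : ℤ) ∣ 2 ^ 2 := by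
      have := dvd_sub (dvd_pow hpT two_ne_zero) (hpD.mul_right (U ^ 2))
      rwa [h] at this
    have h2 : p ∣ 2 := by exact_mod_cast hpz.dvd_of_dvd_pow h4
    rw [(Nat.prime_dvd_prime_iff_eq hp Nat.prime_two).mp h2] at hodd
    exact absurd hodd (by decide)
  have key : (p : ℤ) ^ 2 ∣ ((⟨T, U⟩ : ℤ√D) ^ p).im - p * (T ^ (p - 1) * U) := by
    have him := (Zsqrtd.pow_succ_re_im_modEq D T U (p - 1)).2.symm.dvd
    rw [Nat.cast_pred hp.pos, sub_add_cancel, Nat.sub_add_cancel hp.one_le, mul_assoc] at him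
    exact hD.trans him
  constructor
  · exact (dvd_iff_dvd_of_dvd_sub ((dvd_pow_self _ two_ne_zero).trans key)).mpr
      (dvd_mul_right _ _)
  · rw [dvd_iff_dvd_of_dvd_sub key, sq, mul_dvd_mul_iff_left hpz.ne_zero]
    intro hdvd
    exact (hpz.dvd_or_dvd hdvd).elim (fun hdT => hT (hpz.dvd_of_dvd_pow hdT)) hU
end

section
/- Let p be an odd prime, let D be a positive integer that is not a perfect square, and let T, U be integers with U ≠ 0 and T² − D·U² = 4. Write V(i) := ((⟨T, U⟩ : ℤ[√D])^i).im. Suppose e₁ ≥ 1 satisfies p ∣ V(e₁) while p ∤ V(j) for all 1 ≤ j < e₁, and let m be the p-adic valuation of V(e₁). Then for every k ≥ 1, the least positive integer i such that p^k divides V(i) equals e₁ if k ≤ m, and equals e₁·p^{k−m} if k > m. -/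
/-- Expansion of the powers of `w = a + b√D` modulo powers of `b`. -/
theorem Zsqrtd.exists_pow_eq {D : ℤ} (w : ℤ√D) (n : ℕ) :
    ∃ c d : ℤ, (w ^ (n + 1)).re = w.re ^ (n + 1) + w.im ^ 2 * c ∧
      (w ^ (n + 1)).im = w.im * ((n + 1 : ℕ) * w.re ^ n + w.im ^ 2 * d) := by
  induction n with
  | zero => exact ⟨0, 0, by simp, by simp⟩
  | succ n ih =>
    obtain ⟨c, d, hc, hd⟩ := ih
    refine ⟨w.re * c + D * ((n + 1 : ℕ) * w.re ^ n + w.im ^ 2 * d), c + w.re * d, ?_, ?_⟩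
    · rw [pow_succ w, Zsqrtd.re_mul, hc, hd]
      ring
    · rw [pow_succ w, Zsqrtd.im_mul, hc, hd]
      push_cast
      ring

/-- If `p ∣ im w` and `p ∤ re w`, then `im (w ^ n) / im w` has the same `p`-adic valuation
as `n`. -/
theorem Zsqrtd.exists_im_pow_eq {D : ℤ} {p : ℕ} (hp : p.Prime) (w : ℤ√D)
    (him : (p : ℤ) ∣ w.im) (hre : ¬ (p : ℤ) ∣ w.re) {n : ℕ} (hn : ¬ p ∣ n) (r : ℕ) :
    ∃ u : ℤ, ¬ (p : ℤ) ∣ u ∧ (w ^ (n * p ^ r)).im = (p : ℤ) ^ r * w.im * u := by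
  have hpZ : Prime (p : ℤ) := Nat.prime_iff_prime_int.mp hp
  induction r with
  | zero =>
    obtain ⟨n, rfl⟩ := Nat.exists_eq_succ_of_ne_zero (n := n) (by rintro rfl; simp at hn)
    obtain ⟨c, d, -, hd⟩ := w.exists_pow_eq n
    refine ⟨_, fun hu => ?_, by simpa using hd⟩
    rw [← Nat.cast_succ, dvd_add_left ((him.pow two_ne_zero).mul_right d)] at hu
    rcases hpZ.dvd_or_dvd hu with h1 | h1
    · exact hn (Int.natCast_dvd_natCast.mp h1)
    · exact hre (hpZ.dvd_of_dvd_pow h1)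
  | succ r ih =>
    obtain ⟨u, hu, hw⟩ := ih
    have hre' : ¬ (p : ℤ) ∣ (w ^ (n * p ^ r)).re := by
      obtain ⟨N, hN⟩ := Nat.exists_eq_succ_of_ne_zero (n := n * p ^ r)
        (mul_ne_zero (by rintro rfl; simp at hn) (pow_ne_zero _ hp.ne_zero))
      obtain ⟨c, d, hc, -⟩ := w.exists_pow_eq N
      rw [hN, Nat.succ_eq_add_one, hc, dvd_add_left ((him.pow two_ne_zero).mul_right c)]
      exact fun h1 => hre (hpZ.dvd_of_dvd_pow h1)
    obtain ⟨q, hq⟩ := Nat.exists_eq_succ_of_ne_zero hp.ne_zero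
    obtain ⟨c, d, -, hd⟩ := (w ^ (n * p ^ r)).exists_pow_eq q
    rw [← Nat.succ_eq_add_one, ← hq] at hd
    obtain ⟨b, hb⟩ := him
    refine ⟨u * ((w ^ (n * p ^ r)).re ^ q + p * (p ^ r * b * u) ^ 2 * d), fun h1 => ?_, ?_⟩
    · refine (hpZ.dvd_or_dvd h1).elim hu fun h2 => ?_
      rw [mul_assoc, dvd_add_left (dvd_mul_right _ _)] at h2
      exact hre' (hpZ.dvd_of_dvd_pow h2)
    · rw [pow_succ p, ← mul_assoc, pow_mul, hd, hw, hb]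
      ring

theorem Zsqrtd.im_pow_ne_zero {D : ℤ} (hD : 0 < D) (w : ℤ√D) (hre : w.re ≠ 0) (him : w.im ≠ 0)
    {n : ℕ} (hn : n ≠ 0) : (w ^ n).im ≠ 0 := by
  obtain ⟨n, rfl⟩ := Nat.exists_eq_succ_of_ne_zero hn
  have hT : 0 < w.re ^ 2 := by positivity
  have hU : 0 < w.im ^ 2 := by positivity
  suffices 0 < w.re ^ (n + 1) * (w ^ (n + 1)).re ∧ 0 < w.re ^ n * w.im * (w ^ (n + 1)).im from
    fun h0 => by simp [h0] at this
  clear hn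
  induction n with
  | zero => constructor <;> simp <;> nlinarith
  | succ n ih =>
    obtain ⟨h1, h2⟩ := ih
    rw [pow_succ w (n + 1), Zsqrtd.re_mul, Zsqrtd.im_mul]
    constructor
    · have := add_pos (mul_pos hT h1) (mul_pos (mul_pos hD hT) h2)
      refine this.trans_eq ?_
      ring
    · have := add_pos (mul_pos hU h1) (mul_pos hT h2)
      refine this.trans_eq ?_
      ring


/-- Let `p` be an odd prime, `D` a positive non-square integer, `T, U` integers with `U ≠ 0`
and `T² − D·U² = 4`, and `V i = ((⟨T,U⟩ : ℤ√D)^i).im`. If `e₁` is the least positive index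
with `p ∣ V e₁` and `m` is the `p`-adic valuation of `V e₁`, then for every `k ≥ 1` the least
positive `i` with `p^k ∣ V i` is `e₁` if `k ≤ m`, and `e₁·p^(k−m)` if `k > m`. -/
theorem stmt_12 (p : ℕ) [Fact p.Prime] (hodd : Odd p) (D : ℤ) (hD : 0 < D)
    (hsq : ¬ IsSquare D) (T U : ℤ) (hU : U ≠ 0) (h : T ^ 2 - D * U ^ 2 = 4)
    (V : ℕ → ℤ) (hV : ∀ i : ℕ, V i = ((⟨T, U⟩ : ℤ√D) ^ i).im)
    (e₁ : ℕ) (he₁ : 1 ≤ e₁) (hdvd : (p : ℤ) ∣ V e₁)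
    (hmin : ∀ j : ℕ, 1 ≤ j → j < e₁ → ¬ (p : ℤ) ∣ V j)
    (m : ℕ) (hm : m = padicValInt p (V e₁)) :
    ∀ k : ℕ, 1 ≤ k →
      IsLeast {i : ℕ | 1 ≤ i ∧ (p : ℤ) ^ k ∣ V i}
        (if k ≤ m then e₁ else e₁ * p ^ (k - m)) := by
  intro k hk
  have hp : p.Prime := Fact.out
  have hpZ : Prime (p : ℤ) := Nat.prime_iff_prime_int.mp hp
  have hT : T ≠ 0 := by
    rintro rfl
    nlinarith [mul_nonneg hD.le (sq_nonneg U)]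
  have hcop (i : ℕ) (hi : (p : ℤ) ∣ V i) : ¬ (p : ℤ) ∣ ((⟨T, U⟩ : ℤ√D) ^ i).re := by
    intro hr
    rw [hV] at hi
    have hn : ((⟨T, U⟩ : ℤ√D) ^ i).norm = 4 ^ i := by
      refine (map_pow Zsqrtd.normMonoidHom _ _).trans (congrArg (· ^ i) ?_)
      refine (Zsqrtd.norm_def _).trans ?_
      linear_combination h
    rw [Zsqrtd.norm_def] at hn
    have h4 : (p : ℤ) ∣ 4 ^ i := hn ▸ dvd_sub (hr.mul_left _) (hi.mul_left _)
    rw [show (4 : ℤ) ^ i = 2 ^ (2 * i) by rw [pow_mul]; norm_num] at h4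
    have h2 : p ∣ 2 := by exact_mod_cast hpZ.dvd_of_dvd_pow h4
    rw [(Nat.prime_dvd_prime_iff_eq hp Nat.prime_two).mp h2] at hodd
    exact absurd hodd (by decide)
  have hV0 : V e₁ ≠ 0 := by
    rw [hV]
    exact Zsqrtd.im_pow_ne_zero hD _ hT hU (by omega)
  have hdiv (i : ℕ) (hi : (p : ℤ) ∣ V i) : e₁ ∣ i := by
    induction i using Nat.strong_induction_on with
    | _ i ih =>
      rcases Nat.eq_zero_or_pos i with rfl | hpos
      · exact dvd_zero _
      have hle : e₁ ≤ i := by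
        by_contra hlt
        exact hmin i hpos (by omega) hi
      obtain ⟨j, rfl⟩ := Nat.exists_eq_add_of_le hle
      refine (Nat.dvd_add_right dvd_rfl).mpr (ih j (by omega) ?_)
      rw [hV, pow_add, Zsqrtd.im_mul, ← hV, ← hV, dvd_add_left (hdvd.mul_right _)] at hi
      exact (hpZ.dvd_or_dvd hi).resolve_left (hcop e₁ hdvd)
  have hval (n r : ℕ) (hn : ¬ p ∣ n) : (p : ℤ) ^ k ∣ V (e₁ * (n * p ^ r)) ↔ k ≤ m + r := by
    obtain ⟨u, hu, hw⟩ := Zsqrtd.exists_im_pow_eq hp ((⟨T, U⟩ : ℤ√D) ^ e₁)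
      (hV e₁ ▸ hdvd) (hcop e₁ hdvd) hn r
    have hu0 : u ≠ 0 := by
      rintro rfl
      simp at hu
    have hpr : (p : ℤ) ^ r ≠ 0 := pow_ne_zero _ hpZ.ne_zero
    rw [hV, pow_mul, hw, ← hV, padicValInt_dvd_iff, padicValInt.mul (mul_ne_zero hpr hV0) hu0,
      padicValInt.mul hpr hV0, padicValInt.eq_zero_of_not_dvd hu, ← hm]
    have : padicValInt p ((p : ℤ) ^ r) = r := by
      rw [← Nat.cast_pow, padicValInt.of_nat, padicValNat.prime_pow]
    rw [this]
    simp only [mul_eq_zero, hpr, hV0, hu0, or_self, false_or]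
    omega
  have hif : (if k ≤ m then e₁ else e₁ * p ^ (k - m)) = e₁ * (1 * p ^ (k - m)) := by
    split_ifs with hkm
    · simp [Nat.sub_eq_zero_of_le hkm]
    · rw [one_mul]
  rw [hif]
  refine ⟨⟨Nat.mul_pos he₁ (by have := hp.pos; positivity),
    (hval 1 _ hp.not_dvd_one).mpr (by omega)⟩, ?_⟩
  rintro i ⟨hi1, hi⟩
  obtain ⟨N, rfl⟩ := hdiv i ((dvd_pow_self _ (by omega)).trans hi)
  have hN : N ≠ 0 := by
    rintro rfl
    simp at hi1
  obtain ⟨r, n, hn, rfl⟩ := Nat.exists_eq_pow_mul_and_not_dvd hN p hp.ne_one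
  rw [mul_comm (p ^ r) n] at hi ⊢
  have hkr := (hval n r hn).mp hi
  have hn1 : 1 ≤ n := Nat.one_le_iff_ne_zero.mpr (by rintro rfl; simp at hn)
  exact Nat.mul_le_mul_left _ (Nat.mul_le_mul hn1 (Nat.pow_le_pow_right hp.pos (by omega)))
end

section
/- Let D be a positive integer that is not a perfect square with D ≡ 0 or 1 (mod 4), and let T, U be integers with U ≠ 0 and T² − D·U² = 4. Let u : ℕ → ℤ be a sequence of integers such that ((⟨T, U⟩ : ℤ[√D])^n).im = 2^{n−1}·u(n) for every n ≥ 1. Then the set S = {i ≥ 1 : 2 ∣ u(i)} is nonempty, and its least element e₁ divides 2 − χ₈(D), where χ₈ is the quadratic character modulo 8 (so χ₈(D) = 0 if D is even, χ₈(D) = 1 if D ≡ ±1 (mod 8), and χ₈(D) = −1 if D ≡ ±3 (mod 8)). -/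
/-- With `((⟨T,U⟩ : ℤ√D)^n).im = 2^(n−1)·u n` and `D ≡ 0 or 1 (mod 4)` a positive non-square,
the set `{i ≥ 1 : 2 ∣ u i}` is nonempty and its least element divides `2 − χ₈(D)`. -/
theorem stmt_17 (D : ℤ) (hD : 0 < D) (hsq : ¬ IsSquare D)
    (hD4 : D % 4 = 0 ∨ D % 4 = 1) (T U : ℤ) (hU : U ≠ 0)
    (h : T ^ 2 - D * U ^ 2 = 4) (u : ℕ → ℤ)
    (hu : ∀ n : ℕ, 1 ≤ n → ((⟨T, U⟩ : ℤ√D) ^ n).im = 2 ^ (n - 1) * u n) :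
    {i : ℕ | 1 ≤ i ∧ 2 ∣ u i}.Nonempty ∧
    ∀ e₁ : ℕ, IsLeast {i : ℕ | 1 ≤ i ∧ 2 ∣ u i} e₁ →
      (e₁ : ℤ) ∣ 2 - ZMod.χ₈ (D : ZMod 8) := by
  have u1 : u 1 = U := by simpa using (hu 1 le_rfl).symm
  have u2 : u 2 = T * U := by
    have := hu 2 (by norm_num)
    simp [pow_succ] at this
    linarith
  have u3 : u 3 = U * (T ^ 2 - 1) := by
    have := hu 3 (by norm_num)
    simp [pow_succ] at this
    refine mul_left_cancel₀ (four_ne_zero (α := ℤ)) ?_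
    linear_combination -this - U * h
  rw [ZMod.χ₈_int_eq_if_mod_eight]
  rcases Int.even_or_odd' U with ⟨k, hk | hk⟩
  · have hm : 1 ∈ {i : ℕ | 1 ≤ i ∧ 2 ∣ u i} := ⟨le_rfl, by rw [u1]; exact ⟨k, hk⟩⟩
    refine ⟨⟨1, hm⟩, fun e he => ?_⟩
    have : e = 1 := le_antisymm (he.2 hm) he.1.1
    simp [this]
  have hU1 : ¬ 2 ∣ u 1 := by rw [u1]; omega
  rcases hD4 with hD4 | hD4
  · have hT : 2 ∣ T := by
      refine Int.prime_two.dvd_of_dvd_pow (n := 2) ?_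
      obtain ⟨d, rfl⟩ : 2 ∣ D := by omega
      exact ⟨2 + d * U ^ 2, by linear_combination h⟩
    have hm : 2 ∈ {i : ℕ | 1 ≤ i ∧ 2 ∣ u i} := ⟨by norm_num, by rw [u2]; exact hT.mul_right U⟩
    refine ⟨⟨2, hm⟩, fun e he => ?_⟩
    have h2 := he.2 hm
    have h1 := he.1.1
    rw [if_pos (by omega)]
    interval_cases e <;> norm_num
  · obtain ⟨d, rfl⟩ : ∃ d, D = 4 * d + 1 := ⟨D / 4, by omega⟩
    have hTodd : T % 2 = 1 := by
      by_contra hT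
      obtain ⟨t, rfl⟩ : 2 ∣ T := by omega
      have : 2 * (2 * t ^ 2 - (4 * d + 1) * (2 * k ^ 2 + 2 * k) - 2 * d - 2) = 1 := by
        rw [hk] at h
        linear_combination h
      omega
    obtain ⟨t, rfl⟩ : ∃ t, T = 2 * t + 1 := ⟨T / 2, by omega⟩
    have hd : d % 2 = 1 := by
      obtain ⟨a, ha⟩ := Int.even_mul_succ_self t
      obtain ⟨b, hb⟩ := Int.even_mul_succ_self k
      have : 2 * (a - (4 * d + 1) * b) - d = 1 := by
        refine mul_left_cancel₀ (four_ne_zero (α := ℤ)) ?_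
        rw [hk] at h
        linear_combination h - 4 * ha + 4 * (4 * d + 1) * hb
      omega
    have hm : 3 ∈ {i : ℕ | 1 ≤ i ∧ 2 ∣ u i} :=
      ⟨by norm_num, by rw [u3]; exact ⟨U * (2 * t ^ 2 + 2 * t), by ring⟩⟩
    have hU2 : ¬ 2 ∣ u 2 := by
      rw [u2, Int.prime_two.dvd_mul]
      omega
    refine ⟨⟨3, hm⟩, fun e he => ?_⟩
    have h3 := he.2 hm
    obtain ⟨h1, hdvd⟩ := he.1
    rw [if_neg (by omega), if_neg (by omega)]
    interval_cases e
    · exact absurd hdvd hU1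
    · exact absurd hdvd hU2
    · norm_num
end
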